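/- Let n ≥ 2, let Q be a cube in ℝⁿ with side length r, and let η_j, j ≥ 0, be a smooth partition of unity with η_0 ∈ C_c^∞(2Q), η_j ∈ C_c^∞(2^{j+1}Q \ 2^{j-1}Q), 0 ≤ η_j ≤ 1, |∇η_j| ≤ C(2^j r)^{-1}, and Σ_j η_j = 1. Then for any v ∈ C_c^∞(Q) and any i, m ∈ {1,…,n} and j ≥ 0: ‖∇(η_j ∂_i ∂_m Δ^{-1} v)‖_{L²(2^{j+1}Q)} ≤ C 2^{-j(1+n/2)} ‖∇v‖_{L²(Q)}, where C depends only on n. -/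

import Mathlib

open MeasureTheory

noncomputable section

/-- Euclidean space ℝⁿ. -/
abbrev V (n : ℕ) := EuclideanSpace ℝ (Fin n)

/-- `u` is a smooth compactly supported (complex-valued) test function. -/
def IsTest {n : ℕ} (u : V n → ℂ) : Prop := ContDiff ℝ (⊤ : ℕ∞) u ∧ HasCompactSupport u

/-- Partial derivative of a function in the `j`-th coordinate direction. -/
noncomputable def pd {n : ℕ} (j : Fin n) (φ : V n → ℂ) : V n → ℂ :=
  fun x => fderiv ℝ φ x (EuclideanSpace.single j 1)

/-- The open cube with center `a` and side length `r`. -/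
def cube {n : ℕ} (a : V n) (r : ℝ) : Set (V n) := {x | ∀ i, |x i - a i| < r / 2}

/-- The fundamental solution of the Laplacian on ℝⁿ:
`log‖x‖/(2π)` for `n = 2`, and `-‖x‖^{2-n} / ((n-2) σ_{n-1})` for `n ≥ 3`,
where `σ_{n-1} = n ω_n` is the surface area of the unit sphere. -/
noncomputable def newtonKernel (n : ℕ) (x : V n) : ℝ :=
  if n = 2 then Real.log ‖x‖ / (2 * Real.pi)
  else -‖x‖ ^ (2 - (n : ℝ)) /
    (((n : ℝ) - 2) * (n : ℝ) * (volume (Metric.ball (0 : V n) 1)).toReal)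

/-- The Newtonian potential `Δ⁻¹ v`, i.e. convolution with the fundamental solution. -/
noncomputable def invLap {n : ℕ} (v : V n → ℂ) (x : V n) : ℂ :=
  ∫ y : V n, (newtonKernel n (x - y) : ℂ) * v y

open Filter Topology Set Convolution

/-- Convolution of a real kernel with a complex-valued function. -/
def potential {n : ℕ} (K : V n → ℝ) (v : V n → ℂ) : V n → ℂ :=
  K ⋆[ContinuousLinearMap.lsmul ℝ ℝ, volume] v

theorem potential_apply {n : ℕ} (K : V n → ℝ) (v : V n → ℂ) (x : V n) :
    potential K v x = ∫ y, K y • v (x - y) := rfl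

theorem potential_apply_swap {n : ℕ} (K : V n → ℝ) (v : V n → ℂ) (x : V n) :
    potential K v x = ∫ y, K (x - y) • v y :=
  convolution_eq_swap _

theorem invLap_eq_potential {n : ℕ} (v : V n → ℂ) :
    invLap v = potential (newtonKernel n) v := by
  ext x
  simp only [invLap, potential_apply_swap, Complex.real_smul]

namespace IsTest

variable {n : ℕ} {v : V n → ℂ}

theorem contDiff_nat (hv : IsTest v) (k : ℕ) : ContDiff ℝ k v :=
  hv.1.of_le (by exact_mod_cast le_top)

theorem contDiff_one (hv : IsTest v) : ContDiff ℝ 1 v := hv.contDiff_nat 1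

theorem continuous (hv : IsTest v) : Continuous v := hv.1.continuous

theorem differentiable (hv : IsTest v) : Differentiable ℝ v :=
  hv.contDiff_one.differentiable one_ne_zero

theorem isTest_pd (hv : IsTest v) (i : Fin n) : IsTest (pd i v) :=
  ⟨(hv.1.fderiv_right (m := (⊤ : ℕ∞)) (by simp)).clm_apply contDiff_const, hv.2.fderiv_apply ℝ _⟩

theorem integrable (hv : IsTest v) : Integrable v :=
  hv.continuous.integrable_of_hasCompactSupport hv.2

theorem integrable_norm_sq (hv : IsTest v) : Integrable (fun x => ‖v x‖ ^ 2) := by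
  have hs : HasCompactSupport fun x => ‖v x‖ ^ 2 := by
    refine hv.2.mono fun x hx => ?_
    simpa using hx
  exact (hv.continuous.norm.pow 2).integrable_of_hasCompactSupport hs

theorem pd_comm (hv : IsTest v) (i m : Fin n) : pd i (pd m v) = pd m (pd i v) := by
  have hd : Differentiable ℝ (fderiv ℝ v) :=
    ((hv.contDiff_nat 2).fderiv_right (m := 1) (by norm_num)).differentiable one_ne_zero
  have key : ∀ i m : Fin n, ∀ x, pd i (pd m v) x =
      fderiv ℝ (fderiv ℝ v) x (EuclideanSpace.single i 1) (EuclideanSpace.single m 1) := by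
    intro i m x
    have h := ((hd x).hasFDerivAt.clm_apply
      (hasFDerivAt_const (EuclideanSpace.single m (1 : ℝ)) x)).fderiv
    change fderiv ℝ (fun y => fderiv ℝ v y (EuclideanSpace.single m 1)) x _ = _
    rw [h]
    simp
  ext x
  rw [key, key]
  exact ((hv.contDiff_nat 2).contDiffAt.isSymmSndFDerivAt (by simp)).eq _ _

theorem integrable_smul_comp_sub (hv : IsTest v) {K : V n → ℝ} (hK : LocallyIntegrable K)
    (x : V n) : Integrable (fun y => K y • v (x - y)) :=
  hv.2.convolutionExists_right (ContinuousLinearMap.lsmul ℝ ℝ) hK hv.continuous x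

theorem contDiff_potential (hv : IsTest v) {K : V n → ℝ} (hK : LocallyIntegrable K) :
    ContDiff ℝ (⊤ : ℕ∞) (potential K v) :=
  hv.2.contDiff_convolution_right _ hK hv.1

/-- Derivatives of a potential fall on the density. -/
theorem pd_potential (hv : IsTest v) {K : V n → ℝ} (hK : LocallyIntegrable K) (i : Fin n) :
    pd i (potential K v) = potential K (pd i v) := by
  ext x
  have h := hv.2.hasFDerivAt_convolution_right (ContinuousLinearMap.lsmul ℝ ℝ) hK hv.contDiff_one x
  simp only [pd, potential]
  rw [h.fderiv, convolution_precompR_apply _ hK (hv.2.fderiv ℝ)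
    (hv.contDiff_one.continuous_fderiv one_ne_zero)]
  rfl

/-- Derivatives of the density may be moved to a regular kernel. -/
theorem potential_pd (hv : IsTest v) {K K' : V n → ℝ} (hK : ContDiff ℝ 1 K) (i : Fin n)
    (hK' : ∀ x, fderiv ℝ K x (EuclideanSpace.single i 1) = K' x) :
    potential K (pd i v) = potential K' v := by
  ext x
  obtain rfl : (fun x => fderiv ℝ K x (EuclideanSpace.single i 1)) = K' := funext hK'
  have hd : ∀ y, HasFDerivAt (fun y => v (x - y)) (-fderiv ℝ v (x - y)) y := by
    intro y
    have := (hv.differentiable (x - y)).hasFDerivAt.comp y ((hasFDerivAt_id y).const_sub x)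
    refine this.congr_fderiv ?_
    ext z; simp
  have hKc : Continuous fun x => fderiv ℝ K x (EuclideanSpace.single i 1) :=
    (hK.continuous_fderiv one_ne_zero).clm_apply continuous_const
  have h := integral_smul_fderiv_eq_neg_fderiv_smul_of_integrable (μ := volume) (𝕜 := ℝ)
    (f := K) (g := fun y => v (x - y)) (v := EuclideanSpace.single i (1 : ℝ))
    (hv.integrable_smul_comp_sub hKc.locallyIntegrable x)
    (by
      simp only [(hd _).fderiv, neg_apply, smul_neg]
      exact ((hv.isTest_pd i).integrable_smul_comp_sub hK.continuous.locallyIntegrable x).neg)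
    (hv.integrable_smul_comp_sub hK.continuous.locallyIntegrable x)
    (fun y _ => hK.differentiable one_ne_zero y) (fun y _ => (hd y).differentiableAt)
  simp only [(hd _).fderiv, neg_apply, smul_neg, integral_neg, neg_inj] at h
  exact h

end IsTest

theorem norm_potential_le {n : ℕ} {v : V n → ℂ} (hv : IsTest v) {K : V n → ℝ} {x : V n} {B : ℝ}
    (hB : ∀ y ∈ tsupport v, |K (x - y)| ≤ B) : ‖potential K v x‖ ≤ B * ∫ y, ‖v y‖ := by
  rw [potential_apply_swap, ← integral_const_mul]
  refine norm_integral_le_of_norm_le (hv.integrable.norm.const_mul B) (Eventually.of_forall ?_)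
  intro y
  rw [norm_smul, Real.norm_eq_abs]
  by_cases hy : y ∈ tsupport v
  · exact mul_le_mul_of_nonneg_right (hB y hy) (norm_nonneg _)
  · simp [image_eq_zero_of_notMem_tsupport hy]

theorem sq_integral_mul_le {α : Type*} [MeasurableSpace α] {μ : Measure α} {f g : α → ℝ}
    (hf0 : ∀ x, 0 ≤ f x) (hf : Integrable f μ) (hfg : Integrable (fun x => f x * g x) μ)
    (hfg2 : Integrable (fun x => f x * g x ^ 2) μ) :
    (∫ x, f x * g x ∂μ) ^ 2 ≤ (∫ x, f x ∂μ) * ∫ x, f x * g x ^ 2 ∂μ := by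
  set A := ∫ x, f x ∂μ
  set B := ∫ x, f x * g x ∂μ
  set D := ∫ x, f x * g x ^ 2 ∂μ
  have hA : 0 ≤ A := integral_nonneg hf0
  have key : ∀ t : ℝ, 0 ≤ D - 2 * t * B + t ^ 2 * A := by
    intro t
    have h1 : ∫ x, f x * (g x - t) ^ 2 ∂μ = D - 2 * t * B + t ^ 2 * A := by
      rw [← integral_const_mul, ← integral_const_mul, ← integral_sub hfg2 (hfg.const_mul _),
        ← integral_add (by exact hfg2.sub (hfg.const_mul _)) (hf.const_mul _)]
      congr 1; ext x; ring
    rw [← h1]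
    exact integral_nonneg fun x => mul_nonneg (hf0 x) (sq_nonneg _)
  have h := discrim_le_zero (a := A) (b := -2 * B) (c := D)
    (fun t => by have := key t; nlinarith)
  rw [discrim] at h
  nlinarith

/-- Young's inequality for convolution of an integrable kernel with a square integrable function. -/
theorem integral_norm_potential_sq_le {n : ℕ} {v : V n → ℂ} (hv : IsTest v) {K : V n → ℝ}
    (hK0 : ∀ x, 0 ≤ K x) (hK : Integrable K) :
    ∫ x, ‖potential K v x‖ ^ 2 ≤ (∫ x, K x) ^ 2 * ∫ x, ‖v x‖ ^ 2 := by
  have hc : ∀ x, HasCompactSupport fun y => v (x - y) := fun x =>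
    hv.2.comp_homeomorph (Homeomorph.subLeft x)
  have hcont : ∀ x, Continuous fun y => v (x - y) := fun x =>
    hv.continuous.comp (continuous_const.sub continuous_id)
  have hint : Integrable (K ⋆[ContinuousLinearMap.mul ℝ ℝ, volume] fun y => ‖v y‖ ^ 2) :=
    hK.integrable_convolution _ hv.integrable_norm_sq
  have hi := integral_convolution (ContinuousLinearMap.mul ℝ ℝ) hK hv.integrable_norm_sq
    (μ := volume) (ν := volume)
  rw [ContinuousLinearMap.mul_apply'] at hi
  rw [sq, mul_assoc, ← hi, ← integral_const_mul]
  refine integral_mono_of_nonneg (Eventually.of_forall fun x => by positivity)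
    (hint.const_mul _) (Eventually.of_forall fun x => ?_)
  simp only [convolution_def, ContinuousLinearMap.mul_apply']
  have h1 : ‖potential K v x‖ ≤ ∫ y, K y * ‖v (x - y)‖ := by
    rw [potential_apply]
    refine (norm_integral_le_integral_norm _).trans_eq ?_
    congr 1; ext y
    rw [norm_smul, Real.norm_of_nonneg (hK0 y)]
  have hint1 : Integrable fun y => K y * ‖v (x - y)‖ := by
    refine (hv.integrable_smul_comp_sub hK.locallyIntegrable x).norm.congr ?_
    refine Eventually.of_forall fun y => ?_
    simp only [norm_smul, Real.norm_of_nonneg (hK0 y)]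
  have hint2 : Integrable fun y => K y * ‖v (x - y)‖ ^ 2 := by
    obtain ⟨M, hM⟩ := hv.2.exists_bound_of_continuous hv.continuous
    refine (hK.mul_const (M ^ 2)).mono'
      (hK.aestronglyMeasurable.mul ((hcont x).norm.pow 2).aestronglyMeasurable)
      (Eventually.of_forall fun y => ?_)
    rw [norm_mul, Real.norm_of_nonneg (hK0 y), Real.norm_of_nonneg (by positivity)]
    exact mul_le_mul_of_nonneg_left (pow_le_pow_left₀ (norm_nonneg _) (hM _) 2) (hK0 y)
  exact (pow_le_pow_left₀ (norm_nonneg _) h1 2).trans (sq_integral_mul_le hK0 hK hint1 hint2)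

/-- The regularised norm `√(‖x‖² + ε²)`. -/
def regNorm {n : ℕ} (ε : ℝ) (x : V n) : ℝ := √(‖x‖ ^ 2 + ε ^ 2)

section regNorm

variable {n : ℕ} {ε : ℝ}

theorem regNorm_pos (hε : 0 < ε) (x : V n) : 0 < regNorm ε x :=
  Real.sqrt_pos.2 (by positivity)

theorem regNorm_sq (x : V n) : regNorm ε x ^ 2 = ‖x‖ ^ 2 + ε ^ 2 :=
  Real.sq_sqrt (by positivity)

theorem norm_le_regNorm (x : V n) : ‖x‖ ≤ regNorm ε x :=
  Real.le_sqrt_of_sq_le (by nlinarith [sq_nonneg ε])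

theorem abs_coord_le_regNorm (x : V n) (i : Fin n) : |x i| ≤ regNorm ε x :=
  (PiLp.norm_apply_le x i).trans (norm_le_regNorm x)

theorem contDiff_regNorm (hε : 0 < ε) : ContDiff ℝ 1 (regNorm ε : V n → ℝ) :=
  ((contDiff_norm_sq ℝ).add contDiff_const).sqrt fun x => by positivity

theorem continuous_regNorm : Continuous (regNorm ε : V n → ℝ) := by
  unfold regNorm; fun_prop

theorem regNorm_smul (hε : 0 < ε) (x : V n) : regNorm ε (ε • x) = ε * regNorm 1 x := by
  rw [regNorm, norm_smul, Real.norm_of_nonneg hε.le, mul_pow, ← mul_add_one,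
    Real.sqrt_mul (by positivity), Real.sqrt_sq hε.le, regNorm, one_pow]

/-- Directional derivative along a line, read off from a one-variable derivative. -/
theorem fderiv_apply_eq_of_hasDerivAt {f : V n → ℝ} (hf : ContDiff ℝ 1 f) {x e : V n} {d : ℝ}
    (h : HasDerivAt (fun t : ℝ => f (x + t • e)) d 0) : fderiv ℝ f x e = d :=
  ((hf.differentiable one_ne_zero x).hasFDerivAt.hasLineDerivAt e).unique h

theorem hasDerivAt_coord (x : V n) (i k : Fin n) :
    HasDerivAt (fun t : ℝ => (x + t • EuclideanSpace.single k (1 : ℝ) : V n) i)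
      (if i = k then 1 else 0) 0 := by
  have : HasDerivAt (fun t : ℝ => x i + t * (if i = k then 1 else 0))
      (if i = k then 1 else 0) 0 := by
    simpa using ((hasDerivAt_id (0 : ℝ)).mul_const (if i = k then (1 : ℝ) else 0)).const_add (x i)
  refine this.congr_of_eventuallyEq (Eventually.of_forall fun t => ?_)
  simp

theorem hasDerivAt_regNorm (hε : 0 < ε) (x : V n) (k : Fin n) :
    HasDerivAt (fun t : ℝ => regNorm ε (x + t • EuclideanSpace.single k (1 : ℝ) : V n))
      (x k / regNorm ε x) 0 := by
  have h1 : HasDerivAt (fun t : ℝ => (‖x‖ ^ 2 + 2 * x k * t + t ^ 2) + ε ^ 2) (2 * x k) 0 := by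
    have := ((((hasDerivAt_id (0 : ℝ)).const_mul (2 * x k)).const_add (‖x‖ ^ 2)).add
      ((hasDerivAt_id (0 : ℝ)).pow 2)).add_const (ε ^ 2)
    simpa using this
  have h2 : (fun t : ℝ => regNorm ε (x + t • EuclideanSpace.single k (1 : ℝ) : V n)) =
      fun t => √((‖x‖ ^ 2 + 2 * x k * t + t ^ 2) + ε ^ 2) := by
    ext t
    rw [regNorm, norm_add_sq_real, inner_smul_right, EuclideanSpace.inner_single_right, norm_smul,
      PiLp.norm_single]
    congr 2
    simp
    ring
  rw [h2]
  have h3 : ‖x‖ ^ 2 + 2 * x k * 0 + 0 ^ 2 + ε ^ 2 ≠ 0 := by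
    have : 0 < ‖x‖ ^ 2 + ε ^ 2 := by positivity
    simpa using this.ne'
  convert h1.sqrt h3 using 1
  simp only [regNorm, mul_zero, add_zero, ne_eq, OfNat.ofNat_ne_zero, not_false_eq_true, zero_pow]
  rw [mul_div_mul_left _ _ two_ne_zero]

/-- Regularisation of the gradient kernel `x_m / ‖x‖ⁿ`. -/
def gradKernel (ε : ℝ) (m : Fin n) (x : V n) : ℝ := x m / regNorm ε x ^ n

/-- Regularisation of the Riesz kernel `(δ_{im} ‖x‖² - n x_i x_m) / ‖x‖ⁿ⁺²`. -/
def rieszKernel (ε : ℝ) (i m : Fin n) (x : V n) : ℝ :=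
  (if i = m then 1 else 0) / regNorm ε x ^ n - n * x i * x m / regNorm ε x ^ (n + 2)

/-- The derivative of `rieszKernel ε i m` in the direction `k`. -/
def rieszKernelDeriv (ε : ℝ) (k i m : Fin n) (x : V n) : ℝ :=
  -(n * ((if i = m then 1 else 0) * x k + (if i = k then 1 else 0) * x m +
    (if m = k then 1 else 0) * x i)) / regNorm ε x ^ (n + 2) +
    n * (n + 2) * x i * x m * x k / regNorm ε x ^ (n + 4)

theorem contDiff_coord (i : Fin n) : ContDiff ℝ 1 (fun x : V n => x i) :=
  (EuclideanSpace.proj (𝕜 := ℝ) i).contDiff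

theorem contDiff_gradKernel (hε : 0 < ε) (m : Fin n) : ContDiff ℝ 1 (gradKernel ε m) :=
  (contDiff_coord m).div ((contDiff_regNorm hε).pow n) fun x => (pow_pos (regNorm_pos hε x) _).ne'

theorem contDiff_rieszKernel (hε : 0 < ε) (i m : Fin n) : ContDiff ℝ 1 (rieszKernel ε i m) :=
  (contDiff_const.div ((contDiff_regNorm hε).pow n)
      fun x => (pow_pos (regNorm_pos hε x) _).ne').sub
    (((contDiff_const.mul (contDiff_coord i)).mul (contDiff_coord m)).div
      ((contDiff_regNorm hε).pow (n + 2)) fun x => (pow_pos (regNorm_pos hε x) _).ne')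

theorem continuous_rieszKernelDeriv (hε : 0 < ε) (k i m : Fin n) :
    Continuous (rieszKernelDeriv ε k i m) := by
  have h := fun x : V n => (regNorm_pos hε x).ne'
  have hc : Continuous (regNorm ε : V n → ℝ) := continuous_regNorm
  unfold rieszKernelDeriv
  fun_prop (disch := intro x; exact pow_ne_zero _ (h x))

theorem fderiv_gradKernel (hε : 0 < ε) (i m : Fin n) (x : V n) :
    fderiv ℝ (gradKernel ε m) x (EuclideanSpace.single i 1) = rieszKernel ε i m x := by
  refine fderiv_apply_eq_of_hasDerivAt (contDiff_gradKernel hε m) ?_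
  have hρ := regNorm_pos hε x
  have h := (hasDerivAt_coord x m i).div ((hasDerivAt_regNorm hε x i).pow n)
    (by simpa using (pow_pos hρ n).ne')
  refine h.congr_deriv ?_
  simp only [Pi.pow_apply, zero_smul, add_zero, rieszKernel, eq_comm (a := m)]
  rcases n with _ | n
  · exact i.elim0
  · simp only [Nat.add_sub_cancel]
    push_cast
    field_simp
    ring

theorem fderiv_rieszKernel (hε : 0 < ε) (k i m : Fin n) (x : V n) :
    fderiv ℝ (rieszKernel ε i m) x (EuclideanSpace.single k 1) = rieszKernelDeriv ε k i m x := by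
  refine fderiv_apply_eq_of_hasDerivAt (contDiff_rieszKernel hε i m) ?_
  have hρ := regNorm_pos hε x
  have h := ((hasDerivAt_const (0 : ℝ) (if i = m then (1 : ℝ) else 0)).div
      ((hasDerivAt_regNorm hε x k).pow n) (by simpa using (pow_pos hρ n).ne')).sub
    ((((hasDerivAt_coord x i k).const_mul (n : ℝ)).mul (hasDerivAt_coord x m k)).div
      ((hasDerivAt_regNorm hε x k).pow (n + 2)) (by simpa using (pow_pos hρ (n + 2)).ne'))
  refine h.congr_deriv ?_
  simp only [Pi.pow_apply, Pi.mul_apply, zero_smul, add_zero, rieszKernelDeriv]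
  rcases n with _ | n
  · exact i.elim0
  · simp only [Nat.add_sub_cancel, show n + 1 + 2 - 1 = n + 2 by omega]
    push_cast
    field_simp
    ring

theorem rieszKernel_comm (i m : Fin n) : (rieszKernel ε i m) = rieszKernel ε m i := by
  ext x
  simp only [rieszKernel, eq_comm (a := i)]
  ring

theorem rieszKernelDeriv_symm (i m : Fin n) :
    rieszKernelDeriv ε i i m = rieszKernelDeriv ε m i i := by
  ext x
  simp only [rieszKernelDeriv, eq_comm (a := i)]
  simp
  ring

theorem abs_gradKernel_le (hε : 0 < ε) (m : Fin n) (x : V n) :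
    |gradKernel ε m x| ≤ 1 / regNorm ε x ^ (n - 1) := by
  have hρ := regNorm_pos hε x
  rw [gradKernel, abs_div, abs_of_pos (pow_pos hρ n),
    div_le_div_iff₀ (by positivity) (by positivity),
    one_mul]
  rcases n with _ | n
  · exact m.elim0
  · rw [add_tsub_cancel_right, pow_succ, mul_comm]
    gcongr
    exact abs_coord_le_regNorm x m

theorem abs_rieszKernel_le (hε : 0 < ε) (i m : Fin n) (x : V n) :
    |rieszKernel ε i m x| ≤ (n + 1) / regNorm ε x ^ n := by
  have hρ := regNorm_pos hε x
  have hi := abs_coord_le_regNorm (ε := ε) x i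
  have hm := abs_coord_le_regNorm (ε := ε) x m
  have h1 : |(if i = m then (1 : ℝ) else 0)| ≤ 1 := by split_ifs <;> simp
  have h2 : |rieszKernel ε i m x| ≤ 1 / regNorm ε x ^ n +
      n * regNorm ε x * regNorm ε x / regNorm ε x ^ (n + 2) := by
    refine (abs_sub _ _).trans ?_
    simp only [abs_div, abs_mul, abs_of_pos (pow_pos hρ _), Nat.abs_cast]
    gcongr
  refine h2.trans_eq ?_
  field_simp
  ring

theorem abs_rieszKernelDeriv_le (hε : 0 < ε) (k i m : Fin n) (x : V n) :
    |rieszKernelDeriv ε k i m x| ≤ (n * (n + 5)) / regNorm ε x ^ (n + 1) := by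
  have hρ := regNorm_pos hε x
  have hi := abs_coord_le_regNorm (ε := ε) x i
  have hm := abs_coord_le_regNorm (ε := ε) x m
  have hk := abs_coord_le_regNorm (ε := ε) x k
  have h1 : ∀ a b : Fin n, |(if a = b then (1 : ℝ) else 0)| ≤ 1 := by
    intro a b; split_ifs <;> simp
  have h3 : |(if i = m then 1 else 0) * x k + (if i = k then 1 else 0) * x m +
      (if m = k then 1 else 0) * x i| ≤ 1 * regNorm ε x + 1 * regNorm ε x + 1 * regNorm ε x := by
    refine (abs_add_three _ _ _).trans ?_
    simp only [abs_mul]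
    gcongr <;> apply h1
  have h2 : |rieszKernelDeriv ε k i m x| ≤
      n * (1 * regNorm ε x + 1 * regNorm ε x + 1 * regNorm ε x) / regNorm ε x ^ (n + 2) +
      n * (n + 2) * regNorm ε x * regNorm ε x * regNorm ε x / regNorm ε x ^ (n + 4) := by
    refine (abs_add_le _ _).trans ?_
    simp only [abs_div, abs_neg, abs_mul (n : ℝ), abs_mul _ (x _),
      abs_of_pos (pow_pos hρ _), Nat.abs_cast]
    rw [abs_of_pos (by positivity : (0 : ℝ) < n + 2)]
    gcongr
  refine h2.trans_eq ?_
  field_simp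
  ring

theorem sum_rieszKernel_diag (x : V n) (hε : 0 < ε) :
    ∑ i, rieszKernel ε i i x = n * ε ^ 2 / regNorm ε x ^ (n + 2) := by
  have hρ := regNorm_pos hε x
  have h : ∑ i, x i * x i = ‖x‖ ^ 2 := by
    rw [EuclideanSpace.norm_sq_eq]
    simp [sq]
  simp only [rieszKernel, if_true, Finset.sum_sub_distrib, ← Finset.sum_div, mul_assoc,
    ← Finset.mul_sum, h]
  simp only [Finset.sum_const, Finset.card_univ, Fintype.card_fin, nsmul_eq_mul, mul_one]
  have := regNorm_sq (ε := ε) x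
  rw [show ε ^ 2 = regNorm ε x ^ 2 - ‖x‖ ^ 2 by linarith]
  field_simp
  ring

theorem integrable_inv_regNorm_pow {k : ℕ} (hk : n < k) :
    Integrable (fun x : V n => 1 / regNorm 1 x ^ k) := by
  have h := integrable_rpow_neg_one_add_norm_sq (E := V n) (μ := volume) (r := k)
    (by simpa using hk)
  refine h.congr (Eventually.of_forall fun x => ?_)
  have h0 : (0 : ℝ) ≤ 1 + ‖x‖ ^ 2 := by positivity
  simp only [regNorm]
  rw [neg_div, Real.rpow_neg h0, one_div, one_pow, add_comm (‖x‖ ^ 2), Real.sqrt_eq_rpow,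
    ← Real.rpow_mul_natCast h0]
  congr 2
  ring

/-- The approximate identity obtained as the Laplacian of the regularised fundamental solution. -/
def laplaceKernel (n : ℕ) (ε : ℝ) (x : V n) : ℝ := n * ε ^ 2 / regNorm ε x ^ (n + 2)

theorem integral_laplaceKernel (hε : 0 < ε) :
    Integrable (laplaceKernel n ε) ∧ ∫ x, laplaceKernel n ε x = ∫ x, laplaceKernel n 1 x := by
  have h1 : Integrable (laplaceKernel n 1) := by
    refine ((integrable_inv_regNorm_pow (n := n) (k := n + 2) (by omega)).const_mul n).congr
      (Eventually.of_forall fun x => ?_)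
    simp [laplaceKernel, div_eq_mul_inv]
  have h2 : ∀ x : V n, laplaceKernel n ε (ε • x) = (ε ^ n)⁻¹ * laplaceKernel n 1 x := by
    intro x
    have hρ := regNorm_pos one_pos x
    rw [laplaceKernel, laplaceKernel, regNorm_smul hε]
    field_simp
    ring
  constructor
  · rw [← integrable_comp_smul_iff volume _ hε.ne']
    simp only [h2]
    exact h1.const_mul _
  · have h3 := Measure.integral_comp_smul volume (laplaceKernel n ε) ε
    simp only [h2, integral_const_mul, finrank_euclideanSpace_fin, smul_eq_mul] at h3
    rw [abs_of_pos (by positivity)] at h3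
    exact (mul_left_cancel₀ (by positivity) h3).symm

end regNorm

section decay

variable {n : ℕ} {f g : V n → ℂ} {ε : ℝ} {v : V n → ℂ}

/-- `f` is continuous and bounded by a multiple of `(1 + ‖x‖²)^{-k/2}`. -/
def DecaysAt (k : ℕ) (f : V n → ℂ) : Prop :=
  Continuous f ∧ ∃ C, ∀ x, ‖f x‖ ≤ C / regNorm 1 x ^ k

theorem DecaysAt.integrable_inner {k l : ℕ} (hf : DecaysAt k f) (hg : DecaysAt l g)
    (h : n < k + l) : Integrable (fun x => innerSL ℝ (f x) (g x)) := by
  obtain ⟨hfc, C, hC⟩ := hf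
  obtain ⟨hgc, D, hD⟩ := hg
  refine ((integrable_inv_regNorm_pow h).const_mul (C * D)).mono'
    ((hfc.inner hgc).aestronglyMeasurable) (Eventually.of_forall fun x => ?_)
  have hρ := regNorm_pos one_pos x
  calc ‖innerSL ℝ (f x) (g x)‖ ≤ ‖f x‖ * ‖g x‖ := by
        simpa only [innerSL_apply_apply] using norm_inner_le_norm (𝕜 := ℝ) (f x) (g x)
    _ ≤ (C / regNorm 1 x ^ k) * (D / regNorm 1 x ^ l) :=
        mul_le_mul (hC x) (hD x) (norm_nonneg _) ((norm_nonneg _).trans (hC x))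
    _ = C * D * (1 / regNorm 1 x ^ (k + l)) := by field_simp; ring

/-- A kernel that decays at infinity produces a potential with the same decay. -/
theorem decaysAt_potential (hε : 0 < ε) (hv : IsTest v) {K : V n → ℝ} (hK : Continuous K) {k : ℕ}
    {A : ℝ} (hA : ∀ x, |K x| ≤ A / regNorm ε x ^ k) : DecaysAt k (potential K v) := by
  refine ⟨(hv.contDiff_potential hK.locallyIntegrable).continuous, ?_⟩
  have hA0 : 0 ≤ A := by
    have h := (abs_nonneg _).trans (hA 0)
    have hρ := pow_pos (regNorm_pos hε (0 : V n)) k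
    rw [le_div_iff₀ hρ] at h
    linarith
  obtain ⟨R, hR⟩ := hv.2.isBounded.exists_norm_le
  set M : ℝ := √(2 + (1 + 2 * R ^ 2) / ε ^ 2)
  have hM : 0 < M := Real.sqrt_pos.2 (by positivity)
  have key : ∀ x, ∀ y ∈ tsupport v, regNorm 1 x ≤ M * regNorm ε (x - y) := by
    intro x y hy
    rw [regNorm, regNorm, ← Real.sqrt_mul (by positivity)]
    refine Real.sqrt_le_sqrt ?_
    have h1 : ‖x‖ ≤ ‖x - y‖ + R := by
      have := norm_add_le (x - y) y
      rw [sub_add_cancel] at this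
      linarith [hR y hy]
    have h2 : ‖x‖ ^ 2 ≤ 2 * ‖x - y‖ ^ 2 + 2 * R ^ 2 := by
      nlinarith [norm_nonneg x, norm_nonneg (x - y), sq_nonneg (‖x - y‖ - R)]
    have h3 : (2 + (1 + 2 * R ^ 2) / ε ^ 2) * (‖x - y‖ ^ 2 + ε ^ 2) =
        2 * ‖x - y‖ ^ 2 + (1 + 2 * R ^ 2) +
          (2 * ε ^ 2 + (1 + 2 * R ^ 2) / ε ^ 2 * ‖x - y‖ ^ 2) := by
      field_simp
      ring
    have h4 : 0 ≤ 2 * ε ^ 2 + (1 + 2 * R ^ 2) / ε ^ 2 * ‖x - y‖ ^ 2 := by positivity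
    rw [h3]
    linarith
  refine ⟨A * M ^ k * ∫ y, ‖v y‖, fun x => ?_⟩
  have hx := regNorm_pos one_pos x
  rw [mul_div_right_comm]
  refine norm_potential_le hv fun y hy => (hA _).trans ?_
  have hxy := regNorm_pos hε (x - y)
  rw [div_le_div_iff₀ (by positivity) (by positivity), mul_assoc, ← mul_pow]
  gcongr
  exact key x y hy

theorem integral_inner_pd {k l p q : ℕ} (hf : ContDiff ℝ 1 f) (hg : ContDiff ℝ 1 g) (i : Fin n)
    (hfd : DecaysAt k f) (hgd : DecaysAt l g) (hfd' : DecaysAt p (pd i f))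
    (hgd' : DecaysAt q (pd i g)) (hkl : n < k + l) (hkq : n < k + q) (hpl : n < p + l) :
    ∫ x, innerSL ℝ (f x) (pd i g x) = -∫ x, innerSL ℝ (pd i f x) (g x) :=
  integral_bilinear_fderiv_right_eq_neg_left_of_integrable
    (hfd'.integrable_inner hgd hpl) (hfd.integrable_inner hgd' hkq) (hfd.integrable_inner hgd hkl)
    (fun x _ => hf.differentiable one_ne_zero x) (fun x _ => hg.differentiable one_ne_zero x)

theorem decaysAt_gradKernel (hε : 0 < ε) (hv : IsTest v) (m : Fin n) :
    DecaysAt (n - 1) (potential (gradKernel ε m) v) :=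
  decaysAt_potential hε hv (contDiff_gradKernel hε m).continuous (abs_gradKernel_le hε m)

theorem decaysAt_rieszKernel (hε : 0 < ε) (hv : IsTest v) (i m : Fin n) :
    DecaysAt n (potential (rieszKernel ε i m) v) :=
  decaysAt_potential hε hv (contDiff_rieszKernel hε i m).continuous (abs_rieszKernel_le hε i m)

theorem pd_potential_gradKernel (hε : 0 < ε) (hv : IsTest v) (i m : Fin n) :
    pd i (potential (gradKernel ε m) v) = potential (rieszKernel ε i m) v := by
  rw [hv.pd_potential (contDiff_gradKernel hε m).continuous.locallyIntegrable,
    hv.potential_pd (contDiff_gradKernel hε m) i (fderiv_gradKernel hε i m)]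

theorem pd_potential_rieszKernel (hε : 0 < ε) (hv : IsTest v) (k i m : Fin n) :
    pd k (potential (rieszKernel ε i m) v) = potential (rieszKernelDeriv ε k i m) v := by
  rw [hv.pd_potential (contDiff_rieszKernel hε i m).continuous.locallyIntegrable,
    hv.potential_pd (contDiff_rieszKernel hε i m) k (fderiv_rieszKernel hε k i m)]

theorem integral_norm_sq_rieszKernel (hn : 2 ≤ n) (hε : 0 < ε) (hv : IsTest v) (i m : Fin n) :
    ∫ x, ‖potential (rieszKernel ε i m) v x‖ ^ 2 =
      ∫ x, innerSL ℝ (potential (rieszKernel ε m m) v x) (potential (rieszKernel ε i i) v x) := by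
  have hg : ∀ m, ContDiff ℝ 1 (potential (gradKernel ε m) v) := fun m =>
    (hv.contDiff_potential
      (contDiff_gradKernel hε m).continuous.locallyIntegrable).of_le (by exact_mod_cast le_top)
  have hr : ∀ i m, ContDiff ℝ 1 (potential (rieszKernel ε i m) v) := fun i m =>
    (hv.contDiff_potential
      (contDiff_rieszKernel hε i m).continuous.locallyIntegrable).of_le (by exact_mod_cast le_top)
  have hd : ∀ k i m, DecaysAt (n + 1) (pd k (potential (rieszKernel ε i m) v)) := by
    intro k i m
    rw [pd_potential_rieszKernel hε hv]
    exact decaysAt_potential hε hv (continuous_rieszKernelDeriv hε k i m)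
      (abs_rieszKernelDeriv_le hε k i m)
  have hgd : ∀ i m, DecaysAt n (pd i (potential (gradKernel ε m) v)) := by
    intro i m
    rw [pd_potential_gradKernel hε hv]
    exact decaysAt_rieszKernel hε hv i m
  have h1 := integral_inner_pd (hg m) (hr i m) i (decaysAt_gradKernel hε hv m)
    (decaysAt_rieszKernel hε hv i m) (hgd i m) (hd i i m) (by omega) (by omega) (by omega)
  have h2 := integral_inner_pd (hg m) (hr i i) m (decaysAt_gradKernel hε hv m)
    (decaysAt_rieszKernel hε hv i i) (hgd m m) (hd m i i) (by omega) (by omega) (by omega)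
  rw [pd_potential_gradKernel hε hv, pd_potential_rieszKernel hε hv, rieszKernelDeriv_symm] at h1
  rw [pd_potential_gradKernel hε hv, pd_potential_rieszKernel hε hv, h1, neg_inj] at h2
  rw [← h2]
  congr 1
  ext x
  simp

/-- Uniform `L²` bound for the regularised second-order Riesz transforms. -/
theorem integral_norm_sq_rieszKernel_le (hn : 2 ≤ n) (hε : 0 < ε) (hv : IsTest v) (i m : Fin n) :
    Integrable (fun x => ‖potential (rieszKernel ε i m) v x‖ ^ 2) ∧
    ∫ x, ‖potential (rieszKernel ε i m) v x‖ ^ 2 ≤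
      (∫ x, laplaceKernel n 1 x) ^ 2 * ∫ x, ‖v x‖ ^ 2 := by
  have hint : ∀ i m, Integrable (fun x => ‖potential (rieszKernel ε i m) v x‖ ^ 2) := by
    intro i m
    refine ((decaysAt_rieszKernel hε hv i m).integrable_inner (decaysAt_rieszKernel hε hv i m)
      (by omega)).congr (Eventually.of_forall fun x => ?_)
    simp
  refine ⟨hint i m, ?_⟩
  have hsum : ∀ x, ∑ i, potential (rieszKernel ε i i) v x = potential (laplaceKernel n ε) v x := by
    intro x
    simp only [potential_apply]
    rw [← integral_finsetSum _ fun i _ => hv.integrable_smul_comp_sub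
      (contDiff_rieszKernel hε i i).continuous.locallyIntegrable x]
    congr 1
    ext y
    rw [← Finset.sum_smul, sum_rieszKernel_diag y hε, laplaceKernel]
  have hdiag : ∑ i, ∑ m, ∫ x, ‖potential (rieszKernel ε i m) v x‖ ^ 2 =
      ∫ x, ‖potential (laplaceKernel n ε) v x‖ ^ 2 := by
    have hi : ∀ i m : Fin n, Integrable fun x => innerSL ℝ (potential (rieszKernel ε m m) v x)
        (potential (rieszKernel ε i i) v x) := fun i m =>
      (decaysAt_rieszKernel hε hv m m).integrable_inner (decaysAt_rieszKernel hε hv i i) (by omega)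
    simp only [integral_norm_sq_rieszKernel hn hε hv]
    simp_rw [← integral_finsetSum _ fun m _ => hi _ m]
    rw [← integral_finsetSum _ fun i _ => integrable_finsetSum _ fun m _ => hi i m]
    congr 1
    ext x
    rw [← hsum, ← real_inner_self_eq_norm_sq, sum_inner, Finset.sum_comm]
    simp [inner_sum]
  obtain ⟨hL, hL1⟩ := integral_laplaceKernel (n := n) hε
  have hL0 : ∀ x, 0 ≤ laplaceKernel n ε x := fun x => by
    have := regNorm_pos hε x
    unfold laplaceKernel
    positivity
  have h0 : ∀ i m, 0 ≤ ∫ x, ‖potential (rieszKernel ε i m) v x‖ ^ 2 := fun i m =>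
    integral_nonneg fun x => by positivity
  calc ∫ x, ‖potential (rieszKernel ε i m) v x‖ ^ 2
      ≤ ∑ m, ∫ x, ‖potential (rieszKernel ε i m) v x‖ ^ 2 :=
        Finset.single_le_sum (f := fun m => ∫ x, ‖potential (rieszKernel ε i m) v x‖ ^ 2)
          (fun m _ => h0 i m) (Finset.mem_univ m)
    _ ≤ ∑ i, ∑ m, ∫ x, ‖potential (rieszKernel ε i m) v x‖ ^ 2 :=
        Finset.single_le_sum (f := fun i => ∑ m, ∫ x, ‖potential (rieszKernel ε i m) v x‖ ^ 2)
          (fun i _ => Finset.sum_nonneg fun m _ => h0 i m) (Finset.mem_univ i)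
    _ = ∫ x, ‖potential (laplaceKernel n ε) v x‖ ^ 2 := hdiag
    _ ≤ _ := by
        rw [← hL1]
        exact integral_norm_potential_sq_le hv hL0 hL

end decay

section regNewton

variable {n : ℕ} {ε : ℝ} {v : V n → ℂ}

/-- The fundamental solution with `‖x‖` replaced by `√(‖x‖² + ε²)`. -/
def regNewton (n : ℕ) (ε : ℝ) (x : V n) : ℝ :=
  if n = 2 then Real.log (regNorm ε x) / (2 * Real.pi)
  else -(regNorm ε x ^ (n - 2))⁻¹ /
    (((n : ℝ) - 2) * (n : ℝ) * (volume (Metric.ball (0 : V n) 1)).toReal)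

/-- The normalising constant in the gradient of the fundamental solution. -/
def newtonConst (n : ℕ) : ℝ :=
  if n = 2 then 1 / (2 * Real.pi)
  else ((n : ℝ) - 2) / (((n : ℝ) - 2) * (n : ℝ) * (volume (Metric.ball (0 : V n) 1)).toReal)

theorem regNorm_zero (x : V n) : regNorm 0 x = ‖x‖ := by
  simp [regNorm, Real.sqrt_sq (norm_nonneg x)]

theorem newtonKernel_eq_regNewton (hn : 2 ≤ n) : newtonKernel n = regNewton n 0 := by
  ext x
  rw [newtonKernel, regNewton, regNorm_zero]
  split_ifs with h
  · rfl
  · congr 2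
    rw [← Real.rpow_natCast, ← Real.rpow_neg (norm_nonneg x)]
    congr 1
    push_cast [Nat.cast_sub hn]
    ring

theorem contDiff_regNewton (hε : 0 < ε) : ContDiff ℝ 1 (regNewton n ε) := by
  have hρ := fun x : V n => (regNorm_pos hε x).ne'
  unfold regNewton
  split_ifs with h
  · exact ((contDiff_regNorm hε).log hρ).div_const _
  · exact (((contDiff_regNorm hε).pow _).inv fun x => pow_ne_zero _ (hρ x)).neg.div_const _

theorem fderiv_regNewton (hn : 2 ≤ n) (hε : 0 < ε) (m : Fin n) (x : V n) :
    fderiv ℝ (regNewton n ε) x (EuclideanSpace.single m 1) =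
      newtonConst n * gradKernel ε m x := by
  refine fderiv_apply_eq_of_hasDerivAt (contDiff_regNewton hε) ?_
  have hρ := regNorm_pos hε x
  have hd := hasDerivAt_regNorm hε x m
  unfold regNewton newtonConst gradKernel
  split_ifs with h
  · have h1 := (hd.log (by simpa using hρ.ne')).div_const (2 * Real.pi)
    refine h1.congr_deriv ?_
    subst h
    simp only [zero_smul, add_zero]
    field_simp
  · have h1 := ((hd.pow (n - 2)).inv (by simpa using pow_ne_zero _ hρ.ne')).neg.div_const
      (((n : ℝ) - 2) * (n : ℝ) * (volume (Metric.ball (0 : V n) 1)).toReal)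
    refine h1.congr_deriv ?_
    obtain ⟨k, rfl⟩ : ∃ k, n = k + 3 := ⟨n - 3, by omega⟩
    simp only [Pi.pow_apply, zero_smul, add_zero, show k + 3 - 2 = k + 1 by omega,
      Nat.add_sub_cancel]
    rw [div_mul_eq_mul_div]
    congr 1
    push_cast
    field_simp
    ring

/-- A locally integrable bound for the regularised fundamental solutions, uniform in `ε ≤ 1`. -/
theorem exists_bound_regNewton (hn : 2 ≤ n) :
    ∃ D : V n → ℝ, LocallyIntegrable D ∧
      ∀ ε : ℝ, 0 ≤ ε → ε ≤ 1 → ∀ x, x ≠ 0 → |regNewton n ε x| ≤ D x := by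
  have hloc : ∀ k : ℕ, k < n → LocallyIntegrable (fun x : V n => (‖x‖ ^ k)⁻¹) := by
    intro k hk
    refine locallyIntegrable_of_norm_le_rpow (C := 1) (α := k) (by simp; omega) (by simpa using hk)
      (Eventually.of_forall fun x => ?_) (by fun_prop)
    rw [Real.norm_of_nonneg (by positivity), Real.rpow_neg (norm_nonneg x), Real.rpow_natCast,
      one_mul]
  have hle : ∀ ε x, ‖x‖ ≤ regNorm ε (x : V n) := fun ε x => norm_le_regNorm x
  unfold regNewton
  split_ifs with h
  · refine ⟨fun x => (1 / (2 * Real.pi)) • (‖x‖ + 1 + (‖x‖ ^ 1)⁻¹), ?_, fun ε h0 h1 x hx => ?_⟩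
    · have h1 : LocallyIntegrable fun x : V n => (‖x‖ + 1 : ℝ) :=
        (continuous_norm.add continuous_const).locallyIntegrable
      exact (h1.add (hloc 1 (by omega))).smul (1 / (2 * Real.pi))
    · have hx' : 0 < ‖x‖ := norm_pos_iff.2 hx
      have hρ : 0 < regNorm ε x := hx'.trans_le (hle ε x)
      have h2 : regNorm ε x ≤ ‖x‖ + 1 := by
        refine Real.sqrt_le_iff.2 ⟨by positivity, by nlinarith⟩
      rw [div_eq_mul_one_div, abs_mul, abs_of_pos (by positivity : 0 < 1 / (2 * Real.pi)),
        mul_comm]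
      refine mul_le_mul_of_nonneg_left ?_ (by positivity)
      have h3 : (regNorm ε x)⁻¹ ≤ (‖x‖ ^ 1)⁻¹ := by
        rw [pow_one]
        exact inv_anti₀ hx' (hle ε x)
      have h4 := Real.log_le_self hρ.le
      have h5 := Real.log_le_self (inv_pos.2 hρ).le
      have h6 : 0 < (regNorm ε x)⁻¹ := inv_pos.2 hρ
      rw [Real.log_inv] at h5
      rw [abs_le]
      constructor <;> linarith
  · refine ⟨fun x => |((n : ℝ) - 2) * (n : ℝ) * (volume (Metric.ball (0 : V n) 1)).toReal|⁻¹ •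
      (‖x‖ ^ (n - 2))⁻¹, (hloc (n - 2) (by omega)).smul
      |((n : ℝ) - 2) * (n : ℝ) * (volume (Metric.ball (0 : V n) 1)).toReal|⁻¹,
      fun ε h0 h1 x hx => ?_⟩
    have hx' : 0 < ‖x‖ := norm_pos_iff.2 hx
    have hρ : 0 < regNorm ε x := hx'.trans_le (hle ε x)
    rw [abs_div, abs_neg, abs_of_pos (by positivity : 0 < (regNorm ε x ^ (n - 2))⁻¹),
      div_eq_mul_inv, mul_comm]
    refine mul_le_mul_of_nonneg_left ?_ (by positivity)
    exact inv_anti₀ (by positivity) (pow_le_pow_left₀ hx'.le (hle ε x) _)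

theorem measurable_regNewton (ε : ℝ) : Measurable (regNewton n ε) := by
  have hc : Measurable (regNorm ε : V n → ℝ) := continuous_regNorm.measurable
  unfold regNewton
  split_ifs
  · exact hc.log.div_const _
  · exact ((hc.pow_const _).inv.neg).div_const _

theorem tendsto_regNewton {x : V n} (hx : x ≠ 0) :
    Tendsto (fun ε => regNewton n ε x) (𝓝[>] 0) (𝓝 (regNewton n 0 x)) := by
  have hx' : regNorm 0 x ≠ 0 := by rw [regNorm_zero]; exact norm_ne_zero_iff.2 hx
  have hc : ContinuousAt (fun ε => regNorm ε x) 0 := by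
    unfold regNorm; fun_prop
  refine Tendsto.mono_left ?_ nhdsWithin_le_nhds
  change ContinuousAt (fun ε => regNewton n ε x) 0
  unfold regNewton
  split_ifs
  · exact (hc.log hx').div_const _
  · exact ((hc.pow _).inv₀ (pow_ne_zero _ hx')).neg.div_const _

theorem ae_ne_zero (hn : 2 ≤ n) : ∀ᵐ x : V n, x ≠ 0 := by
  have : Nontrivial (V n) := Module.nontrivial_of_finrank_pos (R := ℝ) (by simp; omega)
  exact Measure.ae_ne volume 0

theorem locallyIntegrable_newtonKernel (hn : 2 ≤ n) : LocallyIntegrable (newtonKernel n) := by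
  obtain ⟨D, hD, h⟩ := exists_bound_regNewton hn
  rw [newtonKernel_eq_regNewton hn]
  refine hD.mono (measurable_regNewton 0).aestronglyMeasurable ?_
  filter_upwards [ae_ne_zero hn] with x hx
  exact (h 0 le_rfl zero_le_one x hx).trans (le_abs_self _)

theorem pd_pd_invLap_eq (hn : 2 ≤ n) (hv : IsTest v) (i m : Fin n) :
    pd i (pd m (invLap v)) = potential (newtonKernel n) (pd i (pd m v)) := by
  have hK := locallyIntegrable_newtonKernel hn
  rw [invLap_eq_potential, hv.pd_potential hK, (hv.isTest_pd m).pd_potential hK]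

theorem contDiff_pd_pd_invLap (hn : 2 ≤ n) (hv : IsTest v) (i m : Fin n) :
    ContDiff ℝ (⊤ : ℕ∞) (pd i (pd m (invLap v))) := by
  rw [pd_pd_invLap_eq hn hv]
  exact ((hv.isTest_pd m).isTest_pd i).contDiff_potential (locallyIntegrable_newtonKernel hn)

theorem pd_pd_pd_invLap (hn : 2 ≤ n) (hv : IsTest v) (k i m : Fin n) :
    pd k (pd i (pd m (invLap v))) = pd i (pd m (invLap (pd k v))) := by
  rw [pd_pd_invLap_eq hn hv, pd_pd_invLap_eq hn (hv.isTest_pd k),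
    ((hv.isTest_pd m).isTest_pd i).pd_potential (locallyIntegrable_newtonKernel hn),
    (hv.isTest_pd m).pd_comm, hv.pd_comm]

/-- The second-order Riesz transform is the limit of its regularisations. -/
theorem tendsto_potential_rieszKernel (hn : 2 ≤ n) (hv : IsTest v) (i m : Fin n) (x : V n) :
    Tendsto (fun ε => newtonConst n • potential (rieszKernel ε i m) v x) (𝓝[>] 0)
      (𝓝 (pd i (pd m (invLap v)) x)) := by
  have hw := (hv.isTest_pd m).isTest_pd i
  have heq : ∀ ε : ℝ, 0 < ε → potential (regNewton n ε) (pd i (pd m v)) x =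
      newtonConst n • potential (rieszKernel ε i m) v x := by
    intro ε hε
    have h1 : potential (fun y => newtonConst n * gradKernel ε i y) (pd m v) x =
        newtonConst n • potential (gradKernel ε i) (pd m v) x := by
      simp only [potential_apply, mul_smul, integral_smul]
    rw [(hv.isTest_pd m).potential_pd (contDiff_regNewton hε) i (fderiv_regNewton hn hε i), h1,
      hv.potential_pd (contDiff_gradKernel hε i) m (fderiv_gradKernel hε m i),
      rieszKernel_comm m i]
  obtain ⟨D, hD, h⟩ := exists_bound_regNewton hn
  have hlim : Tendsto (fun ε => potential (regNewton n ε) (pd i (pd m v)) x) (𝓝[>] 0)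
      (𝓝 (potential (regNewton n 0) (pd i (pd m v)) x)) := by
    simp only [potential_apply]
    have hmem : ∀ᶠ ε : ℝ in 𝓝[>] 0, 0 ≤ ε ∧ ε ≤ 1 := by
      filter_upwards [Ioo_mem_nhdsGT (zero_lt_one' ℝ)] with ε hε using ⟨hε.1.le, hε.2.le⟩
    refine tendsto_integral_filter_of_dominated_convergence
      (fun y => ‖D y • pd i (pd m v) (x - y)‖) ?_ ?_ ?_ ?_
    · refine Eventually.of_forall fun ε => ?_
      exact ((measurable_regNewton ε).aestronglyMeasurable).smul
        (hw.continuous.comp (continuous_const.sub continuous_id)).aestronglyMeasurable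
    · filter_upwards [hmem] with ε hε
      filter_upwards [ae_ne_zero hn] with y hy
      rw [norm_smul, norm_smul]
      gcongr
      exact (h ε hε.1 hε.2 y hy).trans (le_abs_self _)
    · exact (hw.integrable_smul_comp_sub hD x).norm
    · filter_upwards [ae_ne_zero hn] with y hy
      exact (tendsto_regNewton hy).smul_const _
  rw [pd_pd_invLap_eq hn hv, newtonKernel_eq_regNewton hn]
  refine hlim.congr' ?_
  filter_upwards [self_mem_nhdsWithin] with ε hε using heq ε hε

/-- `L²`-boundedness of the second-order Riesz transforms. -/
theorem integral_norm_sq_pd_pd_invLap_le (hn : 2 ≤ n) (hv : IsTest v) (i m : Fin n) :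
    Integrable (fun x => ‖pd i (pd m (invLap v)) x‖ ^ 2) ∧
    ∫ x, ‖pd i (pd m (invLap v)) x‖ ^ 2 ≤
      (newtonConst n * ∫ x, laplaceKernel n 1 x) ^ 2 * ∫ x, ‖v x‖ ^ 2 := by
  set B := (newtonConst n * ∫ x, laplaceKernel n 1 x) ^ 2 * ∫ x, ‖v x‖ ^ 2
  have hB : 0 ≤ B := mul_nonneg (sq_nonneg _) (integral_nonneg fun x => by positivity)
  have hc := (contDiff_pd_pd_invLap hn hv i m).continuous
  have hε : ∀ k : ℕ, (0 : ℝ) < 1 / (k + 1) := fun k => Nat.one_div_pos_of_nat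
  have hseq : Tendsto (fun k : ℕ => 1 / ((k : ℝ) + 1)) atTop (𝓝[>] 0) :=
    tendsto_nhdsWithin_iff.2 ⟨tendsto_one_div_add_atTop_nhds_zero_nat, Eventually.of_forall hε⟩
  have hle : ∫⁻ x, ENNReal.ofReal (‖pd i (pd m (invLap v)) x‖ ^ 2) ≤ ENNReal.ofReal B := by
    have hpt : ∀ x, Tendsto (fun k : ℕ => ENNReal.ofReal
        (‖newtonConst n • potential (rieszKernel (1 / ((k : ℝ) + 1)) i m) v x‖ ^ 2)) atTop
        (𝓝 (ENNReal.ofReal (‖pd i (pd m (invLap v)) x‖ ^ 2))) := fun x =>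
      (ENNReal.continuous_ofReal.tendsto _).comp
        ((((tendsto_potential_rieszKernel hn hv i m x).comp hseq).norm).pow 2)
    have hmeas : ∀ k : ℕ, Measurable fun x => ENNReal.ofReal
        (‖newtonConst n • potential (rieszKernel (1 / ((k : ℝ) + 1)) i m) v x‖ ^ 2) := by
      intro k
      have hcont := (decaysAt_rieszKernel (hε k) hv i m).1
      generalize potential (rieszKernel (1 / ((k : ℝ) + 1)) i m) v = u at hcont ⊢
      exact (Continuous.measurable (by fun_prop)).ennreal_ofReal
    calc ∫⁻ x, ENNReal.ofReal (‖pd i (pd m (invLap v)) x‖ ^ 2)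
        = ∫⁻ x, liminf (fun k : ℕ => ENNReal.ofReal
            (‖newtonConst n • potential (rieszKernel (1 / ((k : ℝ) + 1)) i m) v x‖ ^ 2)) atTop := by
          exact lintegral_congr fun x => (hpt x).liminf_eq.symm
      _ ≤ liminf (fun k : ℕ => ∫⁻ x, ENNReal.ofReal
            (‖newtonConst n • potential (rieszKernel (1 / ((k : ℝ) + 1)) i m) v x‖ ^ 2)) atTop :=
          lintegral_liminf_le hmeas
      _ ≤ liminf (fun _ : ℕ => ENNReal.ofReal B) atTop := by
          refine liminf_le_liminf (Eventually.of_forall fun k => ?_)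
          obtain ⟨h1, h2⟩ := integral_norm_sq_rieszKernel_le hn (hε k) hv i m
          simp only [norm_smul, mul_pow]
          rw [← ofReal_integral_eq_lintegral_ofReal (h1.const_mul _)
            (Eventually.of_forall fun x => by positivity), integral_const_mul]
          refine ENNReal.ofReal_le_ofReal ?_
          rw [Real.norm_eq_abs, sq_abs]
          simp only [B]
          rw [mul_pow, mul_assoc]
          exact mul_le_mul_of_nonneg_left h2 (sq_nonneg _)
      _ = ENNReal.ofReal B := liminf_const _
  have hint : Integrable (fun x => ‖pd i (pd m (invLap v)) x‖ ^ 2) := by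
    refine ⟨(hc.norm.pow 2).aestronglyMeasurable, ?_⟩
    rw [hasFiniteIntegral_iff_ofReal (Eventually.of_forall fun x => by positivity)]
    exact hle.trans_lt ENNReal.ofReal_lt_top
  refine ⟨hint, ?_⟩
  rw [← ofReal_integral_eq_lintegral_ofReal hint
    (Eventually.of_forall fun x => by positivity)] at hle
  exact (ENNReal.ofReal_le_ofReal_iff hB).1 hle

/-- Pointwise decay of the Riesz transform away from the support. -/
theorem norm_pd_pd_invLap_le (hn : 2 ≤ n) (hv : IsTest v) (i m : Fin n) {x : V n} {d : ℝ}
    (hd : 0 < d) (hx : ∀ y ∈ tsupport v, d ≤ ‖x - y‖) :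
    ‖pd i (pd m (invLap v)) x‖ ≤ |newtonConst n| * ((n + 1) / d ^ n * ∫ y, ‖v y‖) := by
  refine le_of_tendsto (tendsto_potential_rieszKernel hn hv i m x).norm ?_
  filter_upwards [self_mem_nhdsWithin] with ε hε
  rw [norm_smul, Real.norm_eq_abs]
  gcongr
  refine norm_potential_le hv fun y hy => (abs_rieszKernel_le hε i m _).trans ?_
  gcongr
  exact (hx y hy).trans (norm_le_regNorm _)

theorem norm_pd_pd_invLap_pd_le (hn : 2 ≤ n) (hv : IsTest v) (k i m : Fin n) {x : V n} {d : ℝ}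
    (hd : 0 < d) (hx : ∀ y ∈ tsupport v, d ≤ ‖x - y‖) :
    ‖pd i (pd m (invLap (pd k v))) x‖ ≤
      |newtonConst n| * (n * (n + 5) / d ^ (n + 1) * ∫ y, ‖v y‖) := by
  refine le_of_tendsto (tendsto_potential_rieszKernel hn (hv.isTest_pd k) i m x).norm ?_
  filter_upwards [self_mem_nhdsWithin] with ε hε
  rw [norm_smul, Real.norm_eq_abs,
    hv.potential_pd (contDiff_rieszKernel hε i m) k (fderiv_rieszKernel hε k i m)]
  gcongr
  refine norm_potential_le hv fun y hy => (abs_rieszKernelDeriv_le hε k i m _).trans ?_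
  gcongr
  exact (hx y hy).trans (norm_le_regNorm _)

end regNewton

section cube

variable {n : ℕ} {a : V n} {r : ℝ} {v : V n → ℂ}

theorem cube_eq_preimage (a : V n) (r : ℝ) :
    cube a r = WithLp.ofLp ⁻¹' univ.pi fun i => Ioo (a i - r / 2) (a i + r / 2) := by
  ext x
  simp only [cube, mem_ofPred_eq, mem_preimage, mem_univ_pi, mem_Ioo, abs_sub_lt_iff]
  exact forall_congr' fun i => ⟨fun h => ⟨by linarith, by linarith⟩,
    fun h => ⟨by linarith, by linarith⟩⟩

theorem measurableSet_cube (a : V n) (r : ℝ) : MeasurableSet (cube a r) := by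
  rw [cube_eq_preimage]
  exact (PiLp.volume_preserving_ofLp (Fin n)).measurable
    (MeasurableSet.univ_pi fun _ => measurableSet_Ioo)

theorem volume_cube (a : V n) (r : ℝ) : volume (cube a r) = ENNReal.ofReal r ^ n := by
  rw [cube_eq_preimage, (PiLp.volume_preserving_ofLp (Fin n)).measure_preimage
    (MeasurableSet.univ_pi fun _ => measurableSet_Ioo).nullMeasurableSet, volume_pi_pi]
  have : ∀ i, a i + r / 2 - (a i - r / 2) = r := fun i => by ring
  simp [Real.volume_Ioo, this]

theorem volume_cube_lt_top (a : V n) (r : ℝ) : volume (cube a r) < ⊤ := by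
  rw [volume_cube]
  exact ENNReal.pow_lt_top ENNReal.ofReal_lt_top

theorem volumeReal_cube (a : V n) (hr : 0 ≤ r) : volume.real (cube a r) = r ^ n := by
  rw [Measure.real, volume_cube, ENNReal.toReal_pow, ENNReal.toReal_ofReal hr]

/-- Two points separated by concentric cubes are at distance at least half the difference of
the side lengths. -/
theorem half_sub_le_norm_sub_of_mem_cube {x y : V n} {s : ℝ} (hx : x ∉ cube a s)
    (hy : y ∈ cube a r) : (s - r) / 2 ≤ ‖x - y‖ := by
  simp only [cube, mem_ofPred_eq, not_forall, not_lt] at hx hy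
  obtain ⟨i, hi⟩ := hx
  have h1 : |x i - a i| ≤ |x i - y i| + |y i - a i| := abs_sub_le _ _ _
  have h2 : |x i - y i| ≤ ‖x - y‖ := by simpa using PiLp.norm_apply_le (x - y) i
  linarith [hy i]

theorem norm_pd_le (i : Fin n) (u : V n → ℂ) (x : V n) : ‖pd i u x‖ ≤ ‖fderiv ℝ u x‖ := by
  simpa [pd] using (fderiv ℝ u x).le_opNorm (EuclideanSpace.single i 1)

theorem norm_fderiv_le_sum_norm_pd (u : V n → ℂ) (x : V n) :
    ‖fderiv ℝ u x‖ ≤ ∑ k, ‖pd k u x‖ := by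
  refine ContinuousLinearMap.opNorm_le_bound _ (Finset.sum_nonneg fun _ _ => norm_nonneg _)
    fun y => ?_
  have hy : y = ∑ k, y k • EuclideanSpace.single k (1 : ℝ) := by
    simpa using ((EuclideanSpace.basisFun (Fin n) ℝ).sum_repr y).symm
  have h : fderiv ℝ u x y = ∑ k, y k • pd k u x := by
    conv_lhs => rw [hy]
    simp [pd]
  rw [h, Finset.sum_mul]
  refine norm_sum_le_of_le _ fun k _ => ?_
  rw [norm_smul, mul_comm]
  gcongr
  exact PiLp.norm_apply_le y k

theorem IsTest.integrable_norm_fderiv_sq (hv : IsTest v) :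
    Integrable fun x => ‖fderiv ℝ v x‖ ^ 2 := by
  have hc : Continuous (fderiv ℝ v) := hv.contDiff_one.continuous_fderiv one_ne_zero
  have hs : HasCompactSupport fun x => ‖fderiv ℝ v x‖ ^ 2 := by
    refine (hv.2.fderiv ℝ).mono fun x hx => ?_
    simpa using hx
  have hc' : Continuous fun x => ‖fderiv ℝ v x‖ ^ 2 := hc.norm.pow 2
  exact hc'.integrable_of_hasCompactSupport hs

theorem IsTest.integral_norm_pd_sq_le (hv : IsTest v) (k : Fin n) :
    ∫ x, ‖pd k v x‖ ^ 2 ≤ ∫ x, ‖fderiv ℝ v x‖ ^ 2 :=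
  integral_mono (hv.isTest_pd k).integrable_norm_sq hv.integrable_norm_fderiv_sq fun x => by
    have := norm_pd_le k v x
    dsimp only
    gcongr

/-- Poincaré's inequality on a cube. -/
theorem IsTest.integral_norm_sq_le (hn : 0 < n) (hv : IsTest v) (hvr : tsupport v ⊆ cube a r) :
    ∫ x, ‖v x‖ ^ 2 ≤ r ^ 2 * ∫ x, ‖fderiv ℝ v x‖ ^ 2 := by
  set i : Fin n := ⟨0, hn⟩
  have hf : ∀ x : V n, HasFDerivAt (fun x : V n => x i - a i)
      (EuclideanSpace.proj i : V n →L[ℝ] ℝ) x := fun x =>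
    (EuclideanSpace.proj i : V n →L[ℝ] ℝ).hasFDerivAt.sub_const _
  have hg : ∀ x, HasFDerivAt (fun x => ‖v x‖ ^ 2) (2 • (innerSL ℝ (v x)).comp (fderiv ℝ v x)) x :=
    fun x => (hv.differentiable x).hasFDerivAt.norm_sq
  have hdf : ∀ x : V n, fderiv ℝ (fun x : V n => x i - a i) x (EuclideanSpace.single i 1) = 1 :=
    fun x => by simp [(hf x).fderiv]
  have hdg : ∀ x, fderiv ℝ (fun x => ‖v x‖ ^ 2) x (EuclideanSpace.single i 1) =
      2 * inner ℝ (v x) (pd i v x) := fun x => by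
    rw [(hg x).fderiv, smul_apply, ContinuousLinearMap.comp_apply,
      innerSL_apply_apply, nsmul_eq_mul, Nat.cast_ofNat, pd]
  have hcf : Continuous fun x : V n => x i - a i := by fun_prop
  have hcg : HasCompactSupport fun x => ‖v x‖ ^ 2 :=
    hv.2.norm.comp_left (g := fun t : ℝ => t ^ 2) (by simp)
  have hcg' : HasCompactSupport fun x => 2 * inner ℝ (v x) (pd i v x) := by
    refine hv.2.mono' fun x hx => subset_tsupport _ fun h => hx ?_
    simp [h]
  have hpd := (hv.isTest_pd i).continuous
  have hint : Integrable fun x => (x i - a i) * (2 * inner ℝ (v x) (pd i v x)) :=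
    (hcf.mul (continuous_const.mul (hv.continuous.inner hpd))).integrable_of_hasCompactSupport
      hcg'.mul_left
  have hibp := integral_mul_fderiv_eq_neg_fderiv_mul_of_integrable (μ := volume)
    (f := fun x : V n => x i - a i) (g := fun x => ‖v x‖ ^ 2) (v := EuclideanSpace.single i 1)
    (by simpa only [hdf, one_mul] using hv.integrable_norm_sq) (by simpa only [hdg] using hint)
    ((hcf.mul (hv.continuous.norm.pow 2)).integrable_of_hasCompactSupport hcg.mul_left)
    (fun x _ => (hf x).differentiableAt) (fun x _ => (hg x).differentiableAt)
  simp only [hdf, hdg, one_mul] at hibp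
  have hle : ∫ x, -((x i - a i) * (2 * inner ℝ (v x) (pd i v x))) ≤
      ∫ x, (1 / 2 * ‖v x‖ ^ 2 + 1 / 2 * (r ^ 2 * ‖fderiv ℝ v x‖ ^ 2)) := by
    refine integral_mono hint.neg ((hv.integrable_norm_sq.const_mul _).add
      ((hv.integrable_norm_fderiv_sq.const_mul _).const_mul _)) fun x => ?_
    by_cases hx : x ∈ tsupport v
    · have h1 : |x i - a i| ≤ r / 2 := (hvr hx i).le
      have h2 : |inner ℝ (v x) (pd i v x)| ≤ ‖v x‖ * ‖fderiv ℝ v x‖ :=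
        (abs_real_inner_le_norm _ _).trans (by gcongr; exact norm_pd_le i v x)
      have h3 : |(x i - a i) * inner ℝ (v x) (pd i v x)| ≤
          r / 2 * (‖v x‖ * ‖fderiv ℝ v x‖) := by
        rw [abs_mul]
        exact mul_le_mul h1 h2 (abs_nonneg _) ((abs_nonneg _).trans h1)
      have h4 := (neg_le_abs _).trans h3
      dsimp only
      nlinarith [sq_nonneg (‖v x‖ - r * ‖fderiv ℝ v x‖)]
    · rw [image_eq_zero_of_notMem_tsupport hx]
      simp only [inner_zero_left, mul_zero, neg_zero]
      positivity
  rw [integral_neg, hibp, neg_neg, integral_add (hv.integrable_norm_sq.const_mul _)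
    ((hv.integrable_norm_fderiv_sq.const_mul _).const_mul _), integral_const_mul,
    integral_const_mul, integral_const_mul] at hle
  linarith

theorem IsTest.sq_integral_norm_le (hv : IsTest v) (hr : 0 ≤ r) (hvr : tsupport v ⊆ cube a r) :
    (∫ x, ‖v x‖) ^ 2 ≤ r ^ n * ∫ x, ‖v x‖ ^ 2 := by
  have hsupp : ∀ (g : V n → ℝ), (∀ x, v x = 0 → g x = 0) →
      (fun x => (cube a r).indicator 1 x * g x) = g := by
    intro g hg
    ext x
    by_cases hx : x ∈ cube a r
    · simp [hx]
    · simp [hx, hg x (image_eq_zero_of_notMem_tsupport fun h => hx (hvr h))]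
  have h1 := hsupp (fun x => ‖v x‖) (by simp)
  have h2 := hsupp (fun x => ‖v x‖ ^ 2) (by simp)
  have h := sq_integral_mul_le (μ := volume) (f := (cube a r).indicator 1) (g := fun x => ‖v x‖)
    (fun x => indicator_nonneg (by simp) x)
    ((integrable_indicator_iff (measurableSet_cube a r)).2
      (integrableOn_const (volume_cube_lt_top a r).ne))
    (by rw [h1]; exact hv.integrable.norm) (by rw [h2]; exact hv.integrable_norm_sq)
  rwa [h1, h2, integral_indicator_one (measurableSet_cube a r), volumeReal_cube a hr] at h

theorem setIntegral_norm_fderiv_sq_eq_integral (hvr : tsupport v ⊆ cube a r) :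
    ∫ x in cube a r, ‖fderiv ℝ v x‖ ^ 2 = ∫ x, ‖fderiv ℝ v x‖ ^ 2 :=
  setIntegral_eq_integral_of_forall_compl_eq_zero fun x hx => by
    simp [fderiv_of_notMem_tsupport ℝ fun h => hx (hvr h)]

end cube

section localised

variable {n : ℕ} {a : V n} {r b : ℝ} {v u : V n → ℂ} {φ : V n → ℝ}

theorem norm_fderiv_ofReal_mul_sq_le (hφ : Differentiable ℝ φ) (hu : Differentiable ℝ u) {x : V n}
    (h0 : 0 ≤ φ x) (h1 : φ x ≤ 1) (hb : ‖fderiv ℝ φ x‖ ≤ b) :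
    ‖fderiv ℝ (fun y => (φ y : ℂ) * u y) x‖ ^ 2 ≤
      2 * (n * ∑ k, ‖pd k u x‖ ^ 2 + b ^ 2 * ‖u x‖ ^ 2) := by
  have hb0 : 0 ≤ b := (norm_nonneg _).trans hb
  have h : ‖fderiv ℝ (fun y => (φ y : ℂ) * u y) x‖ ≤ ∑ k, ‖pd k u x‖ + b * ‖u x‖ := by
    have heq : (fun y => (φ y : ℂ) * u y) = fun y => φ y • u y := by
      ext y; simp
    rw [heq, fderiv_fun_smul (hφ x) (hu x)]
    refine norm_add_le_of_le ?_ ?_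
    · rw [norm_smul, Real.norm_of_nonneg h0]
      exact (mul_le_of_le_one_left (norm_nonneg _) h1).trans (norm_fderiv_le_sum_norm_pd u x)
    · rw [ContinuousLinearMap.norm_smulRight_apply]
      gcongr
  have hs : (∑ k, ‖pd k u x‖) ^ 2 ≤ n * ∑ k, ‖pd k u x‖ ^ 2 := by
    simpa using sq_sum_le_card_mul_sum_sq (s := Finset.univ) (f := fun k => ‖pd k u x‖)
  calc ‖fderiv ℝ (fun y => (φ y : ℂ) * u y) x‖ ^ 2
      ≤ (∑ k, ‖pd k u x‖ + b * ‖u x‖) ^ 2 := by gcongr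
    _ ≤ 2 * ((∑ k, ‖pd k u x‖) ^ 2 + (b * ‖u x‖) ^ 2) := add_sq_le
    _ ≤ _ := by rw [mul_pow]; gcongr

theorem IsTest.integral_norm_sq_fderiv_mul_le (hn : 2 ≤ n) (hv : IsTest v)
    (hvr : tsupport v ⊆ cube a r) (hφ : Differentiable ℝ φ) (h0 : ∀ x, 0 ≤ φ x)
    (h1 : ∀ x, φ x ≤ 1) (hb : ∀ x, ‖fderiv ℝ φ x‖ ≤ b) (i m : Fin n) (s : Set (V n)) :
    ∫ x in s, ‖fderiv ℝ (fun y => (φ y : ℂ) * pd i (pd m (invLap v)) y) x‖ ^ 2 ≤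
      2 * (newtonConst n * ∫ x, laplaceKernel n 1 x) ^ 2 * (n ^ 2 + (b * r) ^ 2) *
        ∫ x, ‖fderiv ℝ v x‖ ^ 2 := by
  set A := (newtonConst n * ∫ x, laplaceKernel n 1 x) ^ 2
  set G := ∫ x, ‖fderiv ℝ v x‖ ^ 2
  have hu : Differentiable ℝ (pd i (pd m (invLap v))) :=
    (contDiff_pd_pd_invLap hn hv i m).differentiable (by simp)
  obtain ⟨hi, hA⟩ := integral_norm_sq_pd_pd_invLap_le hn hv i m
  have hk := fun k => integral_norm_sq_pd_pd_invLap_le hn (hv.isTest_pd k) i m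
  have hint : Integrable fun x => 2 * (n * ∑ k, ‖pd i (pd m (invLap (pd k v))) x‖ ^ 2 +
      b ^ 2 * ‖pd i (pd m (invLap v)) x‖ ^ 2) :=
    (((integrable_finsetSum _ fun k _ => (hk k).1).const_mul _).add (hi.const_mul _)).const_mul _
  have hpt := fun x => norm_fderiv_ofReal_mul_sq_le hφ hu (h0 x) (h1 x) (hb x)
  simp only [pd_pd_pd_invLap hn hv] at hpt
  calc ∫ x in s, ‖fderiv ℝ (fun y => (φ y : ℂ) * pd i (pd m (invLap v)) y) x‖ ^ 2
      ≤ ∫ x in s, 2 * (n * ∑ k, ‖pd i (pd m (invLap (pd k v))) x‖ ^ 2 +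
          b ^ 2 * ‖pd i (pd m (invLap v)) x‖ ^ 2) :=
        integral_mono_of_nonneg (Eventually.of_forall fun x => by positivity)
          hint.integrableOn (Eventually.of_forall hpt)
    _ ≤ ∫ x, 2 * (n * ∑ k, ‖pd i (pd m (invLap (pd k v))) x‖ ^ 2 +
          b ^ 2 * ‖pd i (pd m (invLap v)) x‖ ^ 2) :=
        setIntegral_le_integral hint (Eventually.of_forall fun x => by positivity)
    _ = 2 * (n * (∑ k, ∫ x, ‖pd i (pd m (invLap (pd k v))) x‖ ^ 2) +
          b ^ 2 * ∫ x, ‖pd i (pd m (invLap v)) x‖ ^ 2) := by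
        rw [integral_const_mul, integral_add
          ((integrable_finsetSum _ fun k _ => (hk k).1).const_mul _) (hi.const_mul _),
          integral_const_mul, integral_const_mul, integral_finsetSum _ fun k _ => (hk k).1]
    _ ≤ 2 * (n * ∑ _k : Fin n, A * G + b ^ 2 * (A * (r ^ 2 * G))) := by
        have hA0 : 0 ≤ A := sq_nonneg _
        gcongr with k
        · exact (hk k).2.trans (mul_le_mul_of_nonneg_left (hv.integral_norm_pd_sq_le k) hA0)
        · exact hA.trans (mul_le_mul_of_nonneg_left (hv.integral_norm_sq_le (by omega) hvr) hA0)
    _ = _ := by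
        simp only [Finset.sum_const, Finset.card_univ, Fintype.card_fin, nsmul_eq_mul]
        ring

theorem IsTest.integral_norm_sq_fderiv_mul_le_of_separated (hn : 2 ≤ n) (hv : IsTest v)
    (hr : 0 < r) (hvr : tsupport v ⊆ cube a r) (hφ : Differentiable ℝ φ) (h0 : ∀ x, 0 ≤ φ x)
    (h1 : ∀ x, φ x ≤ 1) (hb : ∀ x, ‖fderiv ℝ φ x‖ ≤ b) {d : ℝ} (hd : 0 < d)
    (hsep : ∀ x ∈ tsupport φ, ∀ y ∈ tsupport v, d ≤ ‖x - y‖) (i m : Fin n) {s : ℝ} (hs : 0 ≤ s) :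
    ∫ x in cube a s, ‖fderiv ℝ (fun y => (φ y : ℂ) * pd i (pd m (invLap v)) y) x‖ ^ 2 ≤
      2 * newtonConst n ^ 2 * (n ^ 2 * (n * (n + 5)) ^ 2 + (b * d) ^ 2 * (n + 1) ^ 2) *
        (s / d) ^ n * (r / d) ^ (n + 2) * ∫ x, ‖fderiv ℝ v x‖ ^ 2 := by
  set G := ∫ x, ‖fderiv ℝ v x‖ ^ 2
  set L := ∫ x, ‖v x‖
  have hL : L ^ 2 ≤ r ^ n * (r ^ 2 * G) := (hv.sq_integral_norm_le hr.le hvr).trans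
    (mul_le_mul_of_nonneg_left (hv.integral_norm_sq_le (by omega) hvr) (by positivity))
  have hu : Differentiable ℝ (pd i (pd m (invLap v))) :=
    (contDiff_pd_pd_invLap hn hv i m).differentiable (by simp)
  have hG : 0 ≤ G := integral_nonneg fun x => by positivity
  set M := 2 * newtonConst n ^ 2 * (n ^ 2 * (n * (n + 5)) ^ 2 + (b * d) ^ 2 * (n + 1) ^ 2) /
    d ^ (2 * n + 2)
  have hM : 0 ≤ M := by positivity
  have hpt : ∀ x, ‖fderiv ℝ (fun y => (φ y : ℂ) * pd i (pd m (invLap v)) y) x‖ ^ 2 ≤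
      M * (r ^ n * (r ^ 2 * G)) := by
    intro x
    by_cases hx : x ∈ tsupport φ
    · have h2 := norm_fderiv_ofReal_mul_sq_le hφ hu (h0 x) (h1 x) (hb x)
      simp only [pd_pd_pd_invLap hn hv] at h2
      have h3 := norm_pd_pd_invLap_le hn hv i m hd (hsep x hx)
      have h4 := fun k => norm_pd_pd_invLap_pd_le hn hv k i m hd (hsep x hx)
      calc _ ≤ _ := h2
        _ ≤ 2 * (n * ∑ _k : Fin n, (|newtonConst n| * (n * (n + 5) / d ^ (n + 1) * L)) ^ 2 +
            b ^ 2 * (|newtonConst n| * ((n + 1) / d ^ n * L)) ^ 2) := by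
          gcongr with k
          exact h4 k
        _ = M * L ^ 2 := by
          simp only [Finset.sum_const, Finset.card_univ, Fintype.card_fin, nsmul_eq_mul, mul_pow,
            sq_abs, M]
          field_simp
          ring
        _ ≤ _ := by gcongr
    · have hx' : x ∉ tsupport fun y => (φ y : ℂ) * pd i (pd m (invLap v)) y := fun h =>
        hx (closure_mono (Function.support_subset_iff'.2 fun y hy => by simp_all) h)
      rw [fderiv_of_notMem_tsupport ℝ hx', norm_zero, zero_pow two_ne_zero]
      positivity
  have h := norm_setIntegral_le_of_norm_le_const (volume_cube_lt_top a s)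
    (f := fun x => ‖fderiv ℝ (fun y => (φ y : ℂ) * pd i (pd m (invLap v)) y) x‖ ^ 2)
    (C := M * (r ^ n * (r ^ 2 * G)))
    fun x _ => by rw [Real.norm_of_nonneg (by positivity)]; exact hpt x
  rw [volumeReal_cube a hs] at h
  refine (le_abs_self _).trans (h.trans_eq ?_)
  simp only [M, div_pow]
  field_simp
  ring

end localised

theorem rpow_half_le_of_le_mul {n j : ℕ} {I K G : ℝ} (hK : 0 ≤ K)
    (h : I ≤ K * ((2 ^ j)⁻¹) ^ (n + 2) * G) :
    I ^ ((1 : ℝ) / 2) ≤ √K * (2 : ℝ) ^ (-((j : ℝ) * (1 + (n : ℝ) / 2))) * G ^ ((1 : ℝ) / 2) := by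
  have hp : ((2 : ℝ) ^ (-((j : ℝ) * (1 + (n : ℝ) / 2)))) ^ 2 = ((2 ^ j)⁻¹) ^ (n + 2) := by
    rw [← Real.rpow_natCast, ← Real.rpow_mul two_pos.le, ← Real.rpow_natCast 2 j,
      ← Real.rpow_neg two_pos.le, ← Real.rpow_natCast, ← Real.rpow_mul two_pos.le]
    congr 1
    push_cast
    ring
  rw [← Real.sqrt_eq_rpow, ← Real.sqrt_eq_rpow]
  refine (Real.sqrt_le_sqrt h).trans_eq ?_
  rw [← hp, Real.sqrt_mul (by positivity), Real.sqrt_mul hK, Real.sqrt_sq (by positivity)]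

/-- Given the standard partition of unity `{η_j}` adapted to a cube `Q` of
side `r`, for any `v ∈ C_c^∞(Q)`, any `i, m` and any `j ≥ 0`,
`‖∇(η_j ∂_i ∂_m Δ⁻¹ v)‖_{L²(2^{j+1}Q)} ≤ C 2^{-j(1+n/2)} ‖∇v‖_{L²(Q)}`,
where `C` depends only on `n` (and on the constant `c₀` in the gradient bound for `η_j`). -/
theorem stmt_9 (n : ℕ) (hn : 2 ≤ n) (c₀ : ℝ) :
    ∃ C : ℝ, ∀ (a : V n) (r : ℝ), 0 < r → ∀ η : ℕ → V n → ℝ,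
      (∀ j, ContDiff ℝ (⊤ : ℕ∞) (η j)) →
      (∀ j x, 0 ≤ η j x ∧ η j x ≤ 1) →
      (tsupport (η 0) ⊆ cube a (2 * r)) →
      (∀ j : ℕ, 1 ≤ j →
        tsupport (η j) ⊆ cube a (2 ^ (j + 1) * r) \ cube a (2 ^ (j - 1) * r)) →
      (∀ j x, ‖fderiv ℝ (η j) x‖ ≤ c₀ * (2 ^ j * r)⁻¹) →
      (∀ x, HasSum (fun j => η j x) 1) →
      ∀ v : V n → ℂ, IsTest v → tsupport v ⊆ cube a r →
      ∀ (i m : Fin n) (j : ℕ),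
        (∫ x in cube a (2 ^ (j + 1) * r),
            ‖fderiv ℝ (fun y => (η j y : ℂ) * pd i (pd m (invLap v)) y) x‖ ^ 2)
            ^ ((1 : ℝ) / 2)
          ≤ C * (2 : ℝ) ^ (-((j : ℝ) * (1 + (n : ℝ) / 2)))
              * (∫ x in cube a r, ‖fderiv ℝ v x‖ ^ 2) ^ ((1 : ℝ) / 2) := by
  set A : ℝ := 2 * (newtonConst n * ∫ x, laplaceKernel n 1 x) ^ 2 * (n ^ 2 + c₀ ^ 2) * 2 ^ (n + 2)
  set B : ℝ := 2 * newtonConst n ^ 2 *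
    (n ^ 2 * (n * (n + 5)) ^ 2 + (c₀ / 8) ^ 2 * (n + 1) ^ 2) * 16 ^ n * 8 ^ (n + 2)
  refine ⟨√(A + B), fun a r hr η hη h01 _ hsupp hgrad _ v hv hvr i m j => ?_⟩
  have hA : 0 ≤ A := by positivity
  have hB : 0 ≤ B := by positivity
  refine rpow_half_le_of_le_mul (add_nonneg hA hB) ?_
  rw [setIntegral_norm_fderiv_sq_eq_integral hvr]
  have hG : 0 ≤ ∫ x, ‖fderiv ℝ v x‖ ^ 2 := integral_nonneg fun x => by positivity
  have hd : Differentiable ℝ (η j) := (hη j).differentiable (by simp)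
  rcases Nat.lt_or_ge j 2 with hj | hj
  · refine (hv.integral_norm_sq_fderiv_mul_le hn hvr hd (fun x => (h01 j x).1)
      (fun x => (h01 j x).2) (hgrad j) i m _).trans (mul_le_mul_of_nonneg_right ?_ hG)
    have hbr : (c₀ * (2 ^ j * r)⁻¹ * r) ^ 2 ≤ c₀ ^ 2 := by
      have h1 : c₀ * (2 ^ j * r)⁻¹ * r = c₀ * (2 ^ j)⁻¹ := by field_simp
      have h2 : ((2 : ℝ) ^ j)⁻¹ ≤ 1 := inv_le_one_of_one_le₀ (one_le_pow₀ one_le_two)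
      rw [h1, mul_pow]
      exact mul_le_of_le_one_right (sq_nonneg _) (pow_le_one₀ (by positivity) h2)
    have h2j : (1 : ℝ) ≤ 2 ^ (n + 2) * ((2 ^ j)⁻¹) ^ (n + 2) := by
      rw [← mul_pow]
      refine one_le_pow₀ ?_
      rw [← div_eq_mul_inv, one_le_div (by positivity)]
      simpa using pow_le_pow_right₀ one_le_two (show j ≤ 1 by omega)
    calc 2 * (newtonConst n * ∫ x, laplaceKernel n 1 x) ^ 2 *
          (n ^ 2 + (c₀ * (2 ^ j * r)⁻¹ * r) ^ 2)
        ≤ 2 * (newtonConst n * ∫ x, laplaceKernel n 1 x) ^ 2 * (n ^ 2 + c₀ ^ 2) := by gcongr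
      _ ≤ 2 * (newtonConst n * ∫ x, laplaceKernel n 1 x) ^ 2 * (n ^ 2 + c₀ ^ 2) *
          (2 ^ (n + 2) * ((2 ^ j)⁻¹) ^ (n + 2)) := le_mul_of_one_le_right (by positivity) h2j
      _ = A * ((2 ^ j)⁻¹) ^ (n + 2) := by simp only [A]; ring
      _ ≤ (A + B) * ((2 ^ j)⁻¹) ^ (n + 2) := by gcongr; linarith
  · have hsep : ∀ x ∈ tsupport (η j), ∀ y ∈ tsupport v, 2 ^ j * r / 8 ≤ ‖x - y‖ := by
      intro x hx y hy
      refine le_trans ?_ (half_sub_le_norm_sub_of_mem_cube (hsupp j (by omega) hx).2 (hvr hy))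
      obtain ⟨k, rfl⟩ : ∃ k, j = k + 2 := ⟨j - 2, by omega⟩
      have hk : r ≤ 2 ^ k * r := le_mul_of_one_le_left hr.le (one_le_pow₀ one_le_two)
      rw [show k + 2 - 1 = k + 1 by omega, pow_succ, pow_add]
      linarith
    refine (hv.integral_norm_sq_fderiv_mul_le_of_separated hn hr hvr hd (fun x => (h01 j x).1)
      (fun x => (h01 j x).2) (hgrad j) (by positivity) hsep i m (by positivity)).trans
      (mul_le_mul_of_nonneg_right ?_ hG)
    have h1 : c₀ * (2 ^ j * r)⁻¹ * (2 ^ j * r / 8) = c₀ / 8 := by field_simp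
    have h2 : 2 ^ (j + 1) * r / (2 ^ j * r / 8) = 16 := by rw [pow_succ]; field_simp; norm_num
    have h3 : r / (2 ^ j * r / 8) = 8 * (2 ^ j)⁻¹ := by field_simp
    rw [h1, h2, h3, mul_pow 8, ← mul_assoc]
    gcongr
    exact le_add_of_nonneg_left hA
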